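/- For all integers 1 ≤ n ≤ m and Z ∈ {X,Y}, the two-colored quantum binomial coefficients satisfy [m+1 choose n]_Z = [m choose n]_{σⁿ(Z)}·[n+1]_Z − [m choose n−1]_Z·[m−n]_{σ^{n+1}(Z)} in ℤ[X,Y]. -/

import Mathlib

/-- The polynomial ring `ℤ[X,Y]`, with the variable `X` indexed by `true` and
the variable `Y` indexed by `false`. -/
noncomputable abbrev TCQ.R₀ : Type := MvPolynomial Bool ℤ

/-- The two-colored quantum numbers `[n]_X, [n]_Y ∈ ℤ[X,Y]`.  The color `Z ∈ {X,Y}` is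
encoded as a `Bool` (`true` for `X`, `false` for `Y`), and `σ(Z)` is `!Z`.
They are defined by `[0]_Z = 0`, `[1]_Z = 1` and `[n+1]_Z = Z·[n]_{σ(Z)} − [n−1]_Z`. -/
noncomputable def TCQ.q : Bool → ℕ → TCQ.R₀
  | _, 0 => 0
  | _, 1 => 1
  | c, (n + 2) => MvPolynomial.X c * TCQ.q (!c) (n + 1) - TCQ.q c n

/-- `binom` is the two-colored quantum binomial coefficient
`[m choose n]_Z = ([m]_Z [m−1]_Z ⋯ [m−n+1]_Z)/([n]_Z [n−1]_Z ⋯ [1]_Z) ∈ ℤ[X,Y]`, i.e.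
it satisfies `[m choose n]_Z · ([n]_Z ⋯ [1]_Z) = [m]_Z ⋯ [m−n+1]_Z` for all `n ≤ m`
(this determines it uniquely, `ℤ[X,Y]` being a domain and the quantum numbers nonzero). -/
def TCQ.IsBinom (binom : Bool → ℕ → ℕ → TCQ.R₀) : Prop :=
  ∀ (Z : Bool) (m n : ℕ), n ≤ m →
    binom Z m n * ∏ i ∈ Finset.range n, TCQ.q Z (i + 1) = ∏ i ∈ Finset.range n, TCQ.q Z (m - i)

namespace TCQ

theorem q_one (c : Bool) : q c 1 = 1 := by
  rw [q]

theorem q_add_two (c : Bool) (n : ℕ) :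
    q c (n + 2) = MvPolynomial.X c * q (!c) (n + 1) - q c n := by
  rw [q]

/-- Quantum numbers of odd index do not depend on the color, while those of even index are
the variable of their color times a color-independent factor. -/
theorem q_not_odd_and_even (k : ℕ) :
    (∀ c, q (!c) (2 * k + 1) = q c (2 * k + 1)) ∧
      ∀ c, MvPolynomial.X c * q (!c) (2 * k) = MvPolynomial.X (!c) * q c (2 * k) := by
  induction k with
  | zero => simp [q]
  | succ k ih =>
    obtain ⟨ho, he⟩ := ih
    have he' : ∀ c, MvPolynomial.X c * q (!c) (2 * (k + 1)) =
        MvPolynomial.X (!c) * q c (2 * (k + 1)) := by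
      intro c
      rw [show 2 * (k + 1) = 2 * k + 2 by ring, q_add_two, q_add_two, Bool.not_not, ho c]
      linear_combination -he c
    refine ⟨fun c => ?_, he'⟩
    have h := he' c
    rw [show 2 * (k + 1) = 2 * k + 1 + 1 by ring] at h
    rw [show 2 * (k + 1) + 1 = 2 * k + 1 + 2 by ring, q_add_two (!c) (2 * k + 1),
      q_add_two c (2 * k + 1), Bool.not_not, ho c]
    linear_combination -h

theorem q_not_of_odd {n : ℕ} (hn : Odd n) (c : Bool) : q (!c) n = q c n := by
  obtain ⟨k, rfl⟩ := hn
  exact (q_not_odd_and_even k).1 c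

theorem X_mul_q_not_of_even {n : ℕ} (hn : Even n) (c : Bool) :
    MvPolynomial.X c * q (!c) n = MvPolynomial.X (!c) * q c n := by
  obtain ⟨k, rfl⟩ := hn.exists_two_nsmul
  exact (q_not_odd_and_even k).2 c

theorem not_iterate_of_odd {n : ℕ} (hn : Odd n) (c : Bool) : Bool.not^[n] c = !c := by
  rw [Bool.involutive_not.iterate_odd hn]

theorem not_iterate_of_even {n : ℕ} (hn : Even n) (c : Bool) : Bool.not^[n] c = c := by
  rw [Bool.involutive_not.iterate_even hn, id]

/-- The recurrence for quantum numbers that keeps the color fixed. -/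
theorem q_add_two' (c : Bool) (n : ℕ) :
    q c (n + 2) = MvPolynomial.X (Bool.not^[n] c) * q c (n + 1) - q c n := by
  rw [q_add_two]
  rcases Nat.even_or_odd n with hn | hn
  · rw [not_iterate_of_even hn, q_not_of_odd hn.add_one]
  · rw [not_iterate_of_odd hn, X_mul_q_not_of_even hn.add_one]

theorem q_add_add_one (c : Bool) (n a : ℕ) :
    q c (a + n + 1) = q (Bool.not^[n] c) (a + 1) * q c (n + 1)
      - q c n * q (Bool.not^[n + 1] c) a := by
  induction a using Nat.twoStepInduction with
  | zero => simp [q]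
  | one =>
    rw [show 1 + n + 1 = n + 2 by ring, q_add_two' c n]
    simp [q]
  | more a ih₀ ih₁ =>
    have h₁ := q_add_two' c (a + n + 1)
    have h₂ := q_add_two' (Bool.not^[n] c) (a + 1)
    have h₃ := q_add_two' (Bool.not^[n + 1] c) a
    rw [← Function.iterate_add_apply] at h₂ h₃
    rw [show a + 1 + n = a + n + 1 by ring] at h₂ ih₁
    rw [show a + (n + 1) = a + n + 1 by ring] at h₃
    rw [show a + 2 + n + 1 = a + n + 1 + 2 by ring, show a + 2 + 1 = a + 1 + 2 by ring,
      h₁, h₂, h₃, ih₀, ih₁]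
    ring

theorem eval_two_q (c : Bool) (n : ℕ) : MvPolynomial.eval (fun _ => (2 : ℤ)) (q c n) = n := by
  induction n using Nat.twoStepInduction generalizing c with
  | zero => simp [q]
  | one => simp [q]
  | more n ih₀ ih₁ =>
    rw [q_add_two, map_sub, map_mul, MvPolynomial.eval_X, ih₀, ih₁]
    push_cast
    ring

theorem q_ne_zero (c : Bool) {n : ℕ} (hn : n ≠ 0) : q c n ≠ 0 := by
  intro h
  have := eval_two_q c n
  rw [h, map_zero] at this
  exact hn (by exact_mod_cast this.symm)

theorem q_mul_q_mul_X {a b : ℕ} (hab : Odd (a + b)) (c : Bool) :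
    q c a * q c b * MvPolynomial.X (!c) = q (!c) a * q (!c) b * MvPolynomial.X c := by
  rcases Nat.even_or_odd a with ha | ha
  · have hb : Odd b := (Nat.odd_add'.1 hab).2 ha
    rw [q_not_of_odd hb]
    linear_combination -q c b * X_mul_q_not_of_even ha c
  · have hb : Even b := (Nat.odd_add.1 hab).1 ha
    rw [q_not_of_odd ha]
    linear_combination -q c a * X_mul_q_not_of_even hb c

theorem prod_q_mul_X_pow (f : ℕ → ℕ) (k : ℕ) (hf : ∀ i < k, Odd (f (2 * i) + f (2 * i + 1)))
    (c : Bool) :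
    (∏ i ∈ Finset.range (2 * k), q c (f i)) * MvPolynomial.X (!c) ^ k =
      (∏ i ∈ Finset.range (2 * k), q (!c) (f i)) * MvPolynomial.X c ^ k := by
  induction k with
  | zero => simp
  | succ k ih =>
    have h := q_mul_q_mul_X (hf k k.lt_succ_self) c
    have ih := ih fun i hi => hf i (by lia)
    rw [show 2 * (k + 1) = 2 * k + 1 + 1 by ring]
    simp only [Finset.prod_range_succ, pow_succ]
    linear_combination (q c (f (2 * k)) * q c (f (2 * k + 1)) * MvPolynomial.X (!c)) * ih +
      (∏ i ∈ Finset.range (2 * k), q (!c) (f i)) * MvPolynomial.X c ^ k * h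

theorem prod_q_mul_prod_q_not (f g : ℕ → ℕ) (k : ℕ)
    (hf : ∀ i < k, Odd (f (2 * i) + f (2 * i + 1)))
    (hg : ∀ i < k, Odd (g (2 * i) + g (2 * i + 1))) (c : Bool) :
    (∏ i ∈ Finset.range (2 * k), q c (f i)) * ∏ i ∈ Finset.range (2 * k), q (!c) (g i) =
      (∏ i ∈ Finset.range (2 * k), q (!c) (f i)) * ∏ i ∈ Finset.range (2 * k), q c (g i) := by
  have hX : (MvPolynomial.X c * MvPolynomial.X (!c) : R₀) ^ k ≠ 0 :=
    pow_ne_zero _ (mul_ne_zero (MvPolynomial.X_ne_zero _) (MvPolynomial.X_ne_zero _))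
  apply mul_right_cancel₀ hX
  have h₁ := prod_q_mul_X_pow f k hf c
  have h₂ := prod_q_mul_X_pow g k hg c
  rw [mul_pow]
  linear_combination
    (∏ i ∈ Finset.range (2 * k), q (!c) (g i)) * MvPolynomial.X c ^ k * h₁ -
      (∏ i ∈ Finset.range (2 * k), q (!c) (f i)) * MvPolynomial.X c ^ k * h₂

theorem prod_q_succ_ne_zero (c : Bool) (n : ℕ) : ∏ i ∈ Finset.range n, q c (i + 1) ≠ 0 :=
  Finset.prod_ne_zero_iff.2 fun i _ => q_ne_zero c i.succ_ne_zero

theorem IsBinom.binom_not_iterate_mul_prod {binom : Bool → ℕ → ℕ → R₀} (hbinom : IsBinom binom)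
    {m j : ℕ} (h : j + 1 ≤ m) (c : Bool) :
    binom (Bool.not^[j + 1] c) m (j + 1) * ∏ i ∈ Finset.range (j + 1), q c (i + 1) =
      (∏ i ∈ Finset.range j, q c (m - i)) * q (Bool.not^[j + 1] c) (m - j) := by
  rcases Nat.even_or_odd j with hj | hj
  · rw [not_iterate_of_odd hj.add_one]
    obtain ⟨k, rfl⟩ := hj.exists_two_nsmul
    rw [smul_eq_mul] at *
    have hb := hbinom (!c) m (2 * k + 1) h
    apply mul_right_cancel₀ (prod_q_succ_ne_zero (!c) (2 * k + 1))
    have hswap := prod_q_mul_prod_q_not (fun i => m - i) (fun i => i + 1 + 1) k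
      (fun i hi => by rw [Nat.odd_iff]; lia) (fun i hi => by rw [Nat.odd_iff]; lia) c
    rw [Finset.prod_range_succ (fun i => q (!c) (m - i))] at hb
    rw [Finset.prod_range_succ' (fun i => q (!c) (i + 1))] at hb ⊢
    rw [Finset.prod_range_succ' (fun i => q c (i + 1))]
    simp only [zero_add, q_one, mul_one] at hb hswap ⊢
    linear_combination (∏ i ∈ Finset.range (2 * k), q c (i + 1 + 1)) * hb -
      q (!c) (m - 2 * k) * hswap
  · rw [not_iterate_of_even hj.add_one, hbinom c m (j + 1) h, Finset.prod_range_succ]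

end TCQ

open TCQ in
/-- for `1 ≤ n ≤ m`,
`[m+1 choose n]_Z = [m choose n]_{σⁿ(Z)}·[n+1]_Z − [m choose n−1]_Z·[m−n]_{σ^{n+1}(Z)}`. -/
theorem tcq_binom_inductive_formula₂ (binom : Bool → ℕ → ℕ → R₀) (hbinom : IsBinom binom)
    (m n : ℕ) (h1 : 1 ≤ n) (h2 : n ≤ m) (Z : Bool) :
    binom Z (m + 1) n = binom (Bool.not^[n] Z) m n * q Z (n + 1)
      - binom Z m (n - 1) * q (Bool.not^[n + 1] Z) (m - n) := by
  obtain ⟨j, rfl⟩ := Nat.exists_eq_add_of_le' h1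
  obtain ⟨a, rfl⟩ := Nat.exists_eq_add_of_le' h2
  apply mul_right_cancel₀ (prod_q_succ_ne_zero Z (j + 1))
  have hl := hbinom Z (a + (j + 1) + 1) (j + 1) (by lia)
  have hm := hbinom.binom_not_iterate_mul_prod h2 Z
  have hr := hbinom Z (a + (j + 1)) j (by lia)
  have hq := q_add_add_one Z (j + 1) a
  rw [Finset.prod_range_succ' (fun i => q Z (a + (j + 1) + 1 - i))] at hl
  simp only [Nat.add_sub_add_right, Nat.sub_zero] at hl
  rw [show a + (j + 1) - j = a + 1 by lia] at hm
  rw [Nat.add_sub_cancel, Nat.add_sub_cancel, hl, sub_mul, mul_right_comm, hm,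
    Finset.prod_range_succ, hq]
  linear_combination q (Bool.not^[j + 1 + 1] Z) a * q Z (j + 1) * hr
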